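/- Let G = (α,β,A) be the two-player zero-sum game with strategy sets the bases S := {x ∈ C : ⟨α,x⟩ = 1} and T := {y ∈ K : ⟨y,β⟩ = 1}, where α ∈ int C* and β ∈ int K*, payoff u(x,y) := ⟨y,Ax⟩, and finite security levels v̲ := sup_{x∈S} inf_{y∈T} u(x,y) and v̄ := inf_{y∈T} sup_{x∈S} u(x,y). Then v̲ = v̄, player I has an optimal strategy (some x* ∈ S with inf_{y∈T} u(x*,y) = v̲), and player II has an optimal strategy (some y* ∈ T with sup_{x∈S} u(x,y*) = v̄). -/

import Mathlib

lemma base_bounded {E : Type*} [NormedAddCommGroup E] [NormedSpace ℝ E]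
    (C : Set E) (α : E →L[ℝ] ℝ) (hα : α ∈ interior {w : E →L[ℝ] ℝ | ∀ x ∈ C, 0 ≤ w x}) :
    Bornology.IsBounded {x ∈ C | α x = 1} := by
  rw [mem_interior_iff_mem_nhds, Metric.mem_nhds_iff] at hα
  obtain ⟨ε, hε, hball⟩ := hα
  rw [isBounded_iff_forall_norm_le]
  refine ⟨2 / ε, ?_⟩
  rintro x ⟨hxC, hx1⟩
  obtain ⟨g, hg, hgx⟩ := exists_dual_vector'' ℝ x
  have hmem : α - (ε / 2) • g ∈ Metric.ball α ε := by
    rw [Metric.mem_ball, dist_eq_norm, sub_sub_cancel_left, norm_neg, norm_smul, Real.norm_eq_abs,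
      abs_of_pos (by positivity)]
    nlinarith
  have h := hball hmem x hxC
  have h2 : g x = ‖x‖ := by simpa using hgx
  simp only [sub_apply, smul_apply, smul_eq_mul, hx1,
    h2] at h
  rw [le_div_iff₀ hε]
  linarith

lemma base_convex {E : Type*} [NormedAddCommGroup E] [NormedSpace ℝ E]
    (C : Set E) (hC : Convex ℝ C) (α : E →L[ℝ] ℝ) : Convex ℝ {x ∈ C | α x = 1} := by
  rintro x ⟨hx, hx1⟩ y ⟨hy, hy1⟩ a b ha hb hab
  exact ⟨hC hx hy ha hb hab, by simp [hx1, hy1, hab]⟩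

lemma base_compact {E : Type*} [NormedAddCommGroup E] [NormedSpace ℝ E]
    (hrefl : Function.Surjective (NormedSpace.inclusionInDoubleDual ℝ E))
    (C : Set E) (hC : Convex ℝ C) (hcl : IsClosed C)
    (α : E →L[ℝ] ℝ) (hα : α ∈ interior {w : E →L[ℝ] ℝ | ∀ x ∈ C, 0 ≤ w x}) :
    IsCompact (toWeakSpace ℝ E '' {x ∈ C | α x = 1}) := by
  have hclS : IsClosed {x ∈ C | α x = 1} :=
    hcl.inter (isClosed_eq α.continuous continuous_const)
  have h1 := (base_convex C hC α).toWeakSpace_closure (𝕜 := ℝ)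
  rw [hclS.closure_eq] at h1
  rw [h1]
  apply NormedSpace.isCompact_closure_of_isBounded
  · rw [Set.preimage_image_eq _ (toWeakSpace ℝ E).injective]
    exact base_bounded C α hα
  · intro z _
    obtain ⟨x, hx⟩ := hrefl (WeakDual.toStrongDual z)
    refine ⟨toWeakSpace ℝ E x, ?_⟩
    refine DFunLike.ext _ _ fun f => ?_
    exact congrArg (fun h => h f) hx

lemma weak_cont {E : Type*} [NormedAddCommGroup E] [NormedSpace ℝ E] (g : E →L[ℝ] ℝ) :
    Continuous (fun x : WeakSpace ℝ E => g ((toWeakSpace ℝ E).symm x)) :=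
  WeakBilin.eval_continuous (topDualPairing ℝ E).flip g

lemma weak_affine {E : Type*} [NormedAddCommGroup E] [NormedSpace ℝ E] (g : E →L[ℝ] ℝ)
    (s : Set (WeakSpace ℝ E)) (hs : Convex ℝ s) :
    QuasilinearOn ℝ s (fun x : WeakSpace ℝ E => g ((toWeakSpace ℝ E).symm x)) := by
  let l : WeakSpace ℝ E →ₗ[ℝ] ℝ := g.toLinearMap.comp (toWeakSpace ℝ E).symm.toLinearMap
  exact ⟨(l.convexOn hs).quasiconvexOn, (l.concaveOn hs).quasiconcaveOn⟩

/-- Theorem 3.3, minimax theorem for bases: for the game G = (α,β,A)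
with α ∈ int C*, β ∈ int K*, strategy sets the bases S, T, payoff ⟨y,Ax⟩ and finite
security levels, v̲ = v̄ and both players have optimal strategies. -/
theorem stmt4
    {X Y : Type*} [NormedAddCommGroup X] [NormedSpace ℝ X] [CompleteSpace X]
    [NormedAddCommGroup Y] [NormedSpace ℝ Y] [CompleteSpace Y]
    -- reflexivity of X and Y
    (hXrefl : Function.Surjective (NormedSpace.inclusionInDoubleDual ℝ X))
    (hYrefl : Function.Surjective (NormedSpace.inclusionInDoubleDual ℝ Y))
    -- continuous linear operator A : X → Y*
    (A : X →L[ℝ] (Y →L[ℝ] ℝ))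
    -- closed convex cones C ⊆ X, K ⊆ Y
    (C : Set X) (K : Set Y)
    (hCcone : ∀ (r : ℝ), 0 ≤ r → ∀ x ∈ C, r • x ∈ C) (hCconv : Convex ℝ C)
    (hCclosed : IsClosed C)
    (hKcone : ∀ (r : ℝ), 0 ≤ r → ∀ y ∈ K, r • y ∈ K) (hKconv : Convex ℝ K)
    (hKclosed : IsClosed K)
    -- positive dual cones with nonempty interior, α ∈ int C*, β ∈ int K*
    (Cstar : Set (X →L[ℝ] ℝ)) (hCstar : Cstar = {w : X →L[ℝ] ℝ | ∀ x ∈ C, 0 ≤ w x})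
    (Kstar : Set (Y →L[ℝ] ℝ)) (hKstar : Kstar = {z : Y →L[ℝ] ℝ | ∀ y ∈ K, 0 ≤ z y})
    (α : X →L[ℝ] ℝ) (hα : α ∈ interior Cstar)
    (β : Y →L[ℝ] ℝ) (hβ : β ∈ interior Kstar)
    -- the bases S and T
    (S : Set X) (hS : S = {x ∈ C | α x = 1})
    (T : Set Y) (hT : T = {y ∈ K | β y = 1})
    -- finite security levels (F3)
    (hSne : S.Nonempty) (hTne : T.Nonempty)
    (hbb : ∀ x ∈ S, BddBelow ((fun y => A x y) '' T))
    (hba : BddAbove ((fun x => sInf ((fun y => A x y) '' T)) '' S))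
    (hba' : ∀ y ∈ T, BddAbove ((fun x => A x y) '' S))
    (hbb' : BddBelow ((fun y => sSup ((fun x => A x y) '' S)) '' T))
    -- lower and upper values
    (vlow vup : ℝ)
    (hvlow : vlow = sSup ((fun x => sInf ((fun y => A x y) '' T)) '' S))
    (hvup : vup = sInf ((fun y => sSup ((fun x => A x y) '' S)) '' T)) :
    vlow = vup ∧
    (∃ xs ∈ S, sInf ((fun y => A xs y) '' T) = vlow) ∧
    (∃ ys ∈ T, sSup ((fun x => A x ys) '' S) = vup) := by
  subst hCstar hKstar
  have kS := base_compact hXrefl C hCconv hCclosed α hα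
  have kT := base_compact hYrefl K hKconv hKclosed β hβ
  have cS := base_convex C hCconv α
  have cT := base_convex K hKconv β
  rw [← hS] at kS cS
  rw [← hT] at kT cT
  have cS' : Convex ℝ (toWeakSpace ℝ X '' S) := cS.linear_image (toWeakSpace ℝ X).toLinearMap
  have cT' : Convex ℝ (toWeakSpace ℝ Y '' T) := cT.linear_image (toWeakSpace ℝ Y).toLinearMap
  obtain ⟨_, ⟨b, hb, rfl⟩, _, ⟨a, ha, rfl⟩, hab⟩ := Sion.exists_isSaddlePointOn
    (X := toWeakSpace ℝ Y '' T) (Y := toWeakSpace ℝ X '' S)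
    (f := fun y x => A ((toWeakSpace ℝ X).symm x) ((toWeakSpace ℝ Y).symm y))
    (hTne.image _) cT' kT
    (fun x _ => (weak_cont (A ((toWeakSpace ℝ X).symm x))).lowerSemicontinuous.lowerSemicontinuousOn _)
    (fun x _ => (weak_affine (A ((toWeakSpace ℝ X).symm x)) _ cT').1)
    cS' (hSne.image _) kS
    (fun y _ => (weak_cont (A.flip ((toWeakSpace ℝ Y).symm y))).upperSemicontinuous.upperSemicontinuousOn _)
    (fun y _ => (weak_affine (A.flip ((toWeakSpace ℝ Y).symm y)) _ cS').2)
  have key : ∀ y ∈ T, ∀ x ∈ S, A x b ≤ A a y := by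
    intro y hy x hx
    simpa using hab _ ⟨y, hy, rfl⟩ _ ⟨x, hx, rfl⟩
  have e1 : sInf ((fun y => A a y) '' T) = A a b := by
    apply IsLeast.csInf_eq
    refine ⟨⟨b, hb, rfl⟩, ?_⟩
    rintro _ ⟨y, hy, rfl⟩
    exact key y hy a ha
  have e2 : sSup ((fun x => A x b) '' S) = A a b := by
    apply IsGreatest.csSup_eq
    refine ⟨⟨a, ha, rfl⟩, ?_⟩
    rintro _ ⟨x, hx, rfl⟩
    exact key b hb x hx
  have e3 : vlow = A a b := by
    rw [hvlow]
    apply IsGreatest.csSup_eq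
    refine ⟨⟨a, ha, e1⟩, ?_⟩
    rintro _ ⟨x, hx, rfl⟩
    exact (csInf_le (hbb x hx) ⟨b, hb, rfl⟩).trans (key b hb x hx)
  have e4 : vup = A a b := by
    rw [hvup]
    apply IsLeast.csInf_eq
    refine ⟨⟨b, hb, e2⟩, ?_⟩
    rintro _ ⟨y, hy, rfl⟩
    exact (key y hy a ha).trans (le_csSup (hba' y hy) ⟨a, ha, rfl⟩)
  exact ⟨e3.trans e4.symm, ⟨a, ha, e1.trans e3.symm⟩, ⟨b, hb, e2.trans e4.symm⟩⟩
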